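/- For integers 0 ≤ ℓ < k, the number of nonnegative integer solutions (y_1,...,y_r) of y_1 + ... + y_r = s with D(y_1) + ... + D(y_r) = t, where D(j) = ⌊(j-ℓ)/(k-ℓ)⌋ for j ≥ k and D(j) = 0 otherwise, equals Σ_{a=1}^{min(r,t)} C(r,a) C(t-1,a-1) C(s - aℓ - (k-ℓ)t; a, r-a; k-ℓ-1, k-1), where C(α; i, r-i; m-1, n-1) = Σ_{j1=0}^{⌊α/m⌋} Σ_{j2=0}^{⌊(α-mj1)/n⌋} (-1)^{j1+j2} C(i,j1) C(r-i,j2) C(α - mj1 - nj2 + r - 1, r-1). -/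

import Mathlib

open Finset

/-- `C(α; i, ri; m-1, n-1)`: allocations of `α` balls into `i + ri` cells, the first `i`
of capacity `m-1`, the rest of capacity `n-1` (vanishing for negative `α`). -/
def Cball (a : ℤ) (i ri m n : ℕ) : ℤ :=
  if a < 0 then 0
  else
    ∑ j1 ∈ Finset.range (a.toNat / m + 1),
      ∑ j2 ∈ Finset.range ((a.toNat - m * j1) / n + 1),
        (-1) ^ (j1 + j2) * (i.choose j1 : ℤ) * (ri.choose j2 : ℤ) *
          (((a.toNat - m * j1 - n * j2 + (i + ri) - 1).choose ((i + ri) - 1)) : ℤ)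

open PowerSeries in
/-- Coefficients of `(1 - X ^ m) ^ i * P`, truncated to the indices where they contribute. -/
theorem coeff_one_sub_X_pow_pow_mul (m i α : ℕ) (hm : 0 < m) (P : ℤ⟦X⟧) :
    coeff α ((1 - X ^ m) ^ i * P) =
      ∑ j ∈ range (α / m + 1), (-1) ^ j * (i.choose j : ℤ) * coeff (α - m * j) P := by
  have hexp : ((1 - X ^ m) ^ i : ℤ⟦X⟧) =
      ∑ j ∈ range (i + 1), C ((-1) ^ j * (i.choose j : ℤ)) * X ^ (m * j) := by
    rw [sub_eq_neg_add, add_pow]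
    refine sum_congr rfl fun j _ => ?_
    rw [neg_pow, ← pow_mul]
    simp only [one_pow, map_mul, map_pow, map_neg, map_one, map_natCast]
    ring
  have hterm : coeff α ((1 - X ^ m) ^ i * P) =
      ∑ j ∈ range (i + 1), (-1) ^ j * (i.choose j : ℤ) *
        (if m * j ≤ α then coeff (α - m * j) P else 0) := by
    rw [hexp, sum_mul, map_sum]
    refine sum_congr rfl fun j _ => ?_
    rw [mul_assoc, coeff_C_mul, coeff_X_pow_mul']
  have hle (j : ℕ) : m * j ≤ α ↔ j < α / m + 1 := by
    rw [Nat.lt_succ_iff, Nat.le_div_iff_mul_le hm, mul_comm]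
  rw [hterm, sum_subset (range_mono (Nat.le_add_right (i + 1) (α / m + 1)))]
  · symm
    rw [← sum_subset (range_mono (Nat.le_add_left (α / m + 1) (i + 1)))]
    · exact sum_congr rfl fun j hj => by rw [if_pos ((hle j).2 (mem_range.1 hj))]
    · intro j _ hj
      rw [if_neg fun h => hj (mem_range.2 ((hle j).1 h)), mul_zero]
  · intro j _ hj
    rw [Nat.choose_eq_zero_of_lt (by simpa using hj)]
    simp

/-- The generating function `1 + X + ⋯ + X ^ (m - 1)` of a cell of capacity `m - 1`. -/
noncomputable def cellSeries (m : ℕ) : PowerSeries ℤ := ∑ j ∈ range m, PowerSeries.X ^ j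

open PowerSeries in
theorem coeff_cellSeries (m j : ℕ) : coeff j (cellSeries m) = if j < m then 1 else 0 := by
  simp [cellSeries, coeff_X_pow]

open PowerSeries in
theorem cellSeries_pow_mul_pow (i ri m n : ℕ) :
    cellSeries m ^ i * cellSeries n ^ ri =
      (1 - X ^ m) ^ i * ((1 - X ^ n) ^ ri * (invOneSubPow ℤ (i + ri) : ℤ⟦X⟧)) := by
  have hgeom (m : ℕ) : (1 - X ^ m : ℤ⟦X⟧) = cellSeries m * (1 - X) :=
    (geom_sum_mul_neg X m).symm
  have hinv : (1 - X : ℤ⟦X⟧) ^ (i + ri) * (invOneSubPow ℤ (i + ri) : ℤ⟦X⟧) = 1 := by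
    rw [← invOneSubPow_inv_eq_one_sub_pow]
    exact (invOneSubPow ℤ (i + ri)).inv_val
  rw [hgeom m, hgeom n, mul_pow, mul_pow]
  calc _ = cellSeries m ^ i * cellSeries n ^ ri *
        ((1 - X : ℤ⟦X⟧) ^ (i + ri) * (invOneSubPow ℤ (i + ri) : ℤ⟦X⟧)) := by
        rw [hinv, mul_one]
    _ = _ := by ring

theorem Cball_natCast (α i ri m n : ℕ) (hm : 0 < m) (hn : 0 < n) (hr : 0 < i + ri) :
    Cball α i ri m n = PowerSeries.coeff α (cellSeries m ^ i * cellSeries n ^ ri) := by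
  obtain ⟨d, hd⟩ : ∃ d, i + ri = d + 1 := ⟨i + ri - 1, by omega⟩
  rw [cellSeries_pow_mul_pow, coeff_one_sub_X_pow_pow_mul _ _ _ hm, Cball,
    if_neg (by omega), Int.toNat_natCast]
  refine sum_congr rfl fun j₁ _ => ?_
  rw [coeff_one_sub_X_pow_pow_mul _ _ _ hn, mul_sum]
  refine sum_congr rfl fun j₂ _ => ?_
  rw [hd, PowerSeries.invOneSubPow_val_succ_eq_mk_add_choose, PowerSeries.coeff_mk,
    Nat.add_sub_cancel, pow_add, Nat.add_comm d (α - m * j₁ - n * j₂), ← Nat.add_assoc,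
    Nat.add_sub_cancel]
  ring

/-- Placing `c` balls aside leaves `s - c` balls, and there is no allocation if `s < c`. -/
theorem Cball_sub (s c i ri m n : ℕ) (hm : 0 < m) (hn : 0 < n) (hr : 0 < i + ri) :
    Cball ((s : ℤ) - c) i ri m n =
      PowerSeries.coeff s (PowerSeries.X ^ c * (cellSeries m ^ i * cellSeries n ^ ri)) := by
  rw [PowerSeries.coeff_X_pow_mul']
  split_ifs with h
  · rw [← Nat.cast_sub h, Cball_natCast _ _ _ _ _ hm hn hr]
  · rw [Cball, if_pos (by omega)]

/-- The number of `l`-overlapping runs of length `k` within `j` consecutive ones. -/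
def runCount (k l j : ℕ) : ℕ := if k ≤ j then (j - l) / (k - l) else 0

/-- The generating function, in the number of ones, of the blocks with exactly `d` runs. -/
noncomputable def runSeries (k l d : ℕ) : PowerSeries ℤ :=
  PowerSeries.mk fun j => if runCount k l j = d then 1 else 0

theorem runCount_eq_zero_iff {k l : ℕ} (hl : l < k) (j : ℕ) : runCount k l j = 0 ↔ j < k := by
  unfold runCount
  split_ifs with h
  · have : 0 < (j - l) / (k - l) := Nat.div_pos (by omega) (by omega)
    omega
  · omega

theorem runCount_eq_succ_iff {k l : ℕ} (hl : l < k) (j d : ℕ) :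
    runCount k l j = d + 1 ↔
      l + (k - l) * (d + 1) ≤ j ∧ j - (l + (k - l) * (d + 1)) < k - l := by
  have hmul : (k - l) * (d + 1) = (k - l) * d + (k - l) := Nat.mul_succ _ _
  unfold runCount
  split_ifs with h
  · rw [Nat.div_eq_iff (by omega), mul_comm (d + 1)]
    omega
  · exact iff_of_false (by simp) (by omega)

theorem runSeries_zero {k l : ℕ} (hl : l < k) : runSeries k l 0 = cellSeries k := by
  ext j
  simp [runSeries, coeff_cellSeries, runCount_eq_zero_iff hl]

theorem runSeries_succ {k l : ℕ} (hl : l < k) (d : ℕ) :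
    runSeries k l (d + 1) =
      PowerSeries.X ^ (l + (k - l) * (d + 1)) * cellSeries (k - l) := by
  ext j
  rw [PowerSeries.coeff_X_pow_mul', runSeries, PowerSeries.coeff_mk, coeff_cellSeries]
  simp only [runCount_eq_succ_iff hl, ite_and]

/-- The bivariate generating function of blocks: the outer variable marks runs, the inner ones. -/
noncomputable def blockSeries (k l : ℕ) : PowerSeries (PowerSeries ℤ) :=
  PowerSeries.mk (runSeries k l)

open PowerSeries in
theorem blockSeries_eq {k l : ℕ} (hl : l < k) :
    blockSeries k l = C (X ^ l * cellSeries (k - l)) *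
      rescale (X ^ (k - l)) (X * (invOneSubPow ℤ⟦X⟧ 1 : ℤ⟦X⟧⟦X⟧)) + C (cellSeries k) := by
  ext1 d
  rw [map_add, coeff_C_mul, coeff_rescale, blockSeries, coeff_mk]
  cases d with
  | zero => simp [runSeries_zero hl]
  | succ d =>
    rw [coeff_succ_X_mul, invOneSubPow_val_succ_eq_mk_add_choose, coeff_mk, runSeries_succ hl,
      coeff_C, if_neg d.succ_ne_zero]
    simp only [zero_add, Nat.choose_zero_right, Nat.cast_one]
    ring

open PowerSeries in
/-- `C(t - 1, a - 1)` counts the compositions of `t` into `a` positive parts. -/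
theorem coeff_X_mul_invOneSubPow_pow {R : Type*} [CommRing R] (t a : ℕ) (ht : 1 ≤ t) :
    coeff t ((X * (invOneSubPow R 1 : R⟦X⟧)) ^ a) =
      if a ∈ Icc 1 t then ((t - 1).choose (a - 1) : R) else 0 := by
  cases a with
  | zero => simp [coeff_one, Nat.one_le_iff_ne_zero.1 ht]
  | succ a =>
    have hpow : (invOneSubPow R 1 : R⟦X⟧) ^ (a + 1) = (invOneSubPow R (a + 1) : R⟦X⟧) := by
      simp [invOneSubPow_eq_inv_one_sub_pow]
    rw [mul_pow, coeff_X_pow_mul', hpow, invOneSubPow_val_succ_eq_mk_add_choose, coeff_mk]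
    simp only [mem_Icc, Nat.le_add_left, true_and, Nat.add_sub_cancel]
    split_ifs with h
    · rw [show a + (t - (a + 1)) = t - 1 by omega]
    · rfl

open PowerSeries in
theorem coeff_coeff_blockSeries_pow {k l : ℕ} (hl : l < k) (r s t : ℕ) (ht : 1 ≤ t) :
    coeff s (coeff t (blockSeries k l ^ r)) =
      ∑ a ∈ Icc 1 (min r t), (r.choose a : ℤ) * ((t - 1).choose (a - 1) : ℤ) *
        coeff s (X ^ (a * l + (k - l) * t) *
          (cellSeries (k - l) ^ a * cellSeries k ^ (r - a))) := by
  have hterm (a : ℕ) : coeff s (coeff t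
      ((C (X ^ l * cellSeries (k - l)) *
        rescale (X ^ (k - l)) (X * (invOneSubPow ℤ⟦X⟧ 1 : ℤ⟦X⟧⟦X⟧))) ^ a *
          C (cellSeries k) ^ (r - a) * (r.choose a : ℤ⟦X⟧⟦X⟧))) =
      if a ∈ Icc 1 t then (r.choose a : ℤ) * ((t - 1).choose (a - 1) : ℤ) *
        coeff s (X ^ (a * l + (k - l) * t) *
          (cellSeries (k - l) ^ a * cellSeries k ^ (r - a))) else 0 := by
    rw [mul_pow, ← map_pow, ← map_pow, ← map_pow, ← map_natCast (C (R := ℤ⟦X⟧)),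
      coeff_mul_C, coeff_mul_C, coeff_C_mul, coeff_rescale, coeff_X_mul_invOneSubPow_pow _ _ ht]
    split_ifs with h
    · rw [← coeff_C_mul, map_mul C, map_natCast C, map_natCast C]
      congr 1
      ring
    · simp
  rw [blockSeries_eq hl, add_pow, map_sum, map_sum, sum_congr rfl fun a _ => hterm a,
    ← sum_filter]
  refine sum_congr ?_ fun _ _ => rfl
  ext a
  simp only [mem_filter, mem_range, mem_Icc]
  omega

open PowerSeries in
/-- Coefficients of a finite product as a sum over bounded tuples. -/
theorem coeff_prod_eq_sum_piFinset {R : Type*} [CommRing R] (r n : ℕ) (f : Fin r → R⟦X⟧) :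
    coeff n (∏ i, f i) =
      ∑ y ∈ (Fintype.piFinset fun _ : Fin r => range (n + 1)) with ∑ i, y i = n,
        ∏ i, coeff (y i) (f i) := by
  rw [coeff_prod]
  refine sum_bij (fun y _ => ⇑y) ?_ (fun _ _ _ _ h => DFunLike.coe_injective h) ?_ fun _ _ => rfl
  · intro y hy
    have hy := (mem_finsuppAntidiag.1 hy).1
    simp only [mem_filter, Fintype.mem_piFinset, mem_range, Nat.lt_succ_iff]
    exact ⟨fun i => hy ▸ single_le_sum (f := y) (fun _ _ => Nat.zero_le _) (mem_univ i), hy⟩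
  · intro y hy
    refine ⟨Finsupp.equivFunOnFinite.symm y, ?_, rfl⟩
    simpa [mem_finsuppAntidiag] using (mem_filter.1 hy).2

open PowerSeries in
theorem card_eq_coeff_coeff_blockSeries_pow (k l r s t : ℕ) :
    ((((Fintype.piFinset fun _ : Fin r => range (s + 1)).filter
        (fun y => (∑ i, y i) = s ∧ (∑ i, runCount k l (y i)) = t)).card : ℤ)) =
      coeff s (coeff t (blockSeries k l ^ r)) := by
  have hpow : blockSeries k l ^ r = ∏ _i : Fin r, blockSeries k l := by simp
  rw [hpow, coeff_prod_eq_sum_piFinset, map_sum]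
  simp only [coeff_prod_eq_sum_piFinset, blockSeries, runSeries, coeff_mk]
  rw [sum_comm, ← filter_filter, card_filter, Nat.cast_sum]
  refine sum_congr rfl fun y _ => ?_
  simp only [prod_boole, mem_univ, true_imp_iff, ← funext_iff (f := fun i => runCount k l (y i)),
    sum_ite_eq]
  push_cast
  refine if_congr ?_ rfl rfl
  simp only [mem_filter, Fintype.mem_piFinset, mem_range, Nat.lt_succ_iff]
  refine ⟨fun h => ⟨fun i => ?_, h⟩, And.right⟩
  exact h ▸ single_le_sum (f := fun i => runCount k l (y i)) (fun _ _ => Nat.zero_le _)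
    (mem_univ i)

theorem E1_count_eq (k l r s t : ℕ) (hl : l < k) (ht : 1 ≤ t) :
    ((((Fintype.piFinset fun _ : Fin r => Finset.range (s + 1)).filter
        (fun y => (∑ i, y i) = s ∧
          (∑ i, if k ≤ y i then (y i - l) / (k - l) else 0) = t)).card : ℤ)) =
      ∑ a ∈ Finset.Icc 1 (min r t),
        (r.choose a : ℤ) * ((t - 1).choose (a - 1) : ℤ) *
          Cball ((s : ℤ) - a * l - (k - l : ℕ) * t) a (r - a) (k - l) k := by
  refine (card_eq_coeff_coeff_blockSeries_pow k l r s t).trans ?_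
  rw [coeff_coeff_blockSeries_pow hl r s t ht]
  refine sum_congr rfl fun a ha => ?_
  have ha := mem_Icc.1 ha
  rw [← Cball_sub s _ a (r - a) (k - l) k (by omega) (by omega) (by omega)]
  push_cast
  rw [sub_sub]
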